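/- In the MDP-with-data setup, let Q⁻ be a bounded measurable fixed point of the robust Bellman operator, Q⁻ = T_rob⁻ Q⁻, with V⁻(s) := ∫ Q⁻(s,a) π(da|s) and V⁻_{d₁} := (1−γ) ∫ V⁻ dd₁. Fix a bounded measurable β : S×A → ℝ and suppose q_β : S×A → ℝ is a bounded measurable fixed point of the β-Bellman operator, q_β = T_β⁻ q_β. Then for every bounded measurable w : S×A → ℝ: E_{ν,P}[ ψ(s,a,s'; w, q_β, β) ] = (1−γ) ∫ v_β dd₁ ≤ V⁻_{d₁}, where v_β(s) := ∫ q_β(s,a) π(da|s). -/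

import Mathlib

open MeasureTheory ProbabilityTheory

/-- Lower conditional value-at-risk at level `τ`. -/
noncomputable def cvarLower {S : Type*} [MeasurableSpace S] (τ : ℝ) (v : S → ℝ)
    (P : Measure S) : ℝ :=
  ⨆ b : ℝ, b + τ⁻¹ * ∫ x, min (v x - b) 0 ∂P

/-- `τ(s,a) := 1/(1+Λ(s,a))`. -/
noncomputable def tauOf {Z : Type*} (Λ : Z → ℝ) (z : Z) : ℝ := (1 + Λ z)⁻¹

/-- `λ(s,a) := 1 − Λ(s,a)⁻¹`. -/
noncomputable def lamOf {Z : Type*} (Λ : Z → ℝ) (z : Z) : ℝ := 1 - (Λ z)⁻¹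

/-- `v(s) := ∫ q(s,a) π(da|s)`. -/
noncomputable def vOf {S A : Type*} [MeasurableSpace S] [MeasurableSpace A]
    (π : Kernel S A) (q : S × A → ℝ) (s : S) : ℝ :=
  ∫ a, q (s, a) ∂(π s)

/-- Robust Bellman operator
`T_rob⁻ f(s,a) = r(s,a) + γ(1−λ) ∫ f̄ dP(·|s,a) + γ λ CVaR⁻_{τ(s,a)}(f̄; P(·|s,a))`. -/
noncomputable def robustBellman {S A : Type*} [MeasurableSpace S] [MeasurableSpace A]
    (P : Kernel (S × A) S) (π : Kernel S A) (r : S × A → ℝ) (γ : ℝ) (Λ : S × A → ℝ)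
    (f : S × A → ℝ) (sa : S × A) : ℝ :=
  r sa + γ * (1 - lamOf Λ sa) * (∫ s', vOf π f s' ∂(P sa)) +
    γ * lamOf Λ sa * cvarLower (tauOf Λ sa) (vOf π f) (P sa)

/-- β-Bellman operator
`T_β⁻ f(s,a) = r + γ(1−λ) ∫ f̄ dP + γ λ (β(s,a) + τ⁻¹ ∫ min(f̄(s') − β(s,a), 0) dP)`. -/
noncomputable def betaBellman {S A : Type*} [MeasurableSpace S] [MeasurableSpace A]
    (P : Kernel (S × A) S) (π : Kernel S A) (r : S × A → ℝ) (γ : ℝ) (Λ : S × A → ℝ)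
    (β : S × A → ℝ) (f : S × A → ℝ) (sa : S × A) : ℝ :=
  r sa + γ * (1 - lamOf Λ sa) * (∫ s', vOf π f s' ∂(P sa)) +
    γ * lamOf Λ sa *
      (β sa + (tauOf Λ sa)⁻¹ * ∫ s', min (vOf π f s' - β sa) 0 ∂(P sa))

/-- `ρ(s,a,s'; v, β) = (1−λ) v(s') + λ (β(s,a) + τ⁻¹ min(v(s') − β(s,a), 0))`. -/
noncomputable def rho {S A : Type*} (Λ : S × A → ℝ) (v : S → ℝ) (β : S × A → ℝ)
    (sa : S × A) (s' : S) : ℝ :=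
  (1 - lamOf Λ sa) * v s' +
    lamOf Λ sa * (β sa + (tauOf Λ sa)⁻¹ * min (v s' - β sa) 0)

/-- The (recentered) EIF integrand `ψ`. -/
noncomputable def psi {S A : Type*} [MeasurableSpace S] [MeasurableSpace A]
    (π : Kernel S A) (r : S × A → ℝ) (γ : ℝ) (d1 : Measure S) (Λ : S × A → ℝ)
    (w q β : S × A → ℝ) (sa : S × A) (s' : S) : ℝ :=
  (1 - γ) * (∫ s, vOf π q s ∂d1) +
    w sa * (r sa + γ * rho Λ (vOf π q) β sa s' - q sa)

section BoundedFunctions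

variable {S A : Type*} [MeasurableSpace S] [MeasurableSpace A]

theorem integrable_kernel_section (π : Kernel S A) [IsMarkovKernel π] {q : S × A → ℝ}
    (hq : Measurable q) {M : ℝ} (hM : ∀ sa, |q sa| ≤ M) (s : S) :
    Integrable (fun a => q (s, a)) (π s) :=
  Integrable.of_bound (hq.comp measurable_prodMk_left).aestronglyMeasurable M
    (ae_of_all _ fun a => hM (s, a))

theorem abs_vOf_le (π : Kernel S A) [IsMarkovKernel π] {q : S × A → ℝ} {M : ℝ}
    (hM : ∀ sa, |q sa| ≤ M) (s : S) : |vOf π q s| ≤ M := by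
  simpa [vOf] using norm_integral_le_of_norm_le_const (μ := π s) (f := fun a => q (s, a))
    (ae_of_all _ fun a => hM (s, a))

theorem measurable_vOf (π : Kernel S A) [IsMarkovKernel π] {q : S × A → ℝ}
    (hq : Measurable q) : Measurable (vOf π q) :=
  (hq.stronglyMeasurable.integral_kernel_prod_right' (κ := π)).measurable

theorem integrable_vOf (π : Kernel S A) [IsMarkovKernel π] {q : S × A → ℝ}
    (hq : Measurable q) {M : ℝ} (hM : ∀ sa, |q sa| ≤ M) (μ : Measure S) [IsFiniteMeasure μ] :
    Integrable (vOf π q) μ :=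
  Integrable.of_bound (measurable_vOf π hq).aestronglyMeasurable M
    (ae_of_all _ fun s => abs_vOf_le π hM s)

theorem vOf_le_vOf_add (π : Kernel S A) [IsMarkovKernel π] {f g : S × A → ℝ}
    (hf : Measurable f) {Mf : ℝ} (hMf : ∀ sa, |f sa| ≤ Mf)
    (hg : Measurable g) {Mg : ℝ} (hMg : ∀ sa, |g sa| ≤ Mg)
    {D : ℝ} (h : ∀ sa, f sa ≤ g sa + D) (s : S) : vOf π f s ≤ vOf π g s + D := by
  have hgi := integrable_kernel_section π hg hMg s
  calc vOf π f s ≤ ∫ a, (g (s, a) + D) ∂(π s) :=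
        integral_mono (integrable_kernel_section π hf hMf s)
          (hgi.add (integrable_const D)) fun a => h (s, a)
    _ = vOf π g s + D := by
        rw [integral_add hgi (integrable_const D)]
        simp [vOf]

theorem integrable_min_sub {μ : Measure S} [IsFiniteMeasure μ] {v : S → ℝ}
    (hv : Integrable v μ) (b : ℝ) : Integrable (fun x => min (v x - b) 0) μ :=
  (hv.sub (integrable_const b)).inf (integrable_zero _ _ _)

/-- For levels in `(0, 1]` the dual objective is bounded by the mean. -/
theorem cvar_objective_le_integral {μ : Measure S} [IsProbabilityMeasure μ] {v : S → ℝ}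
    (hv : Integrable v μ) {τ : ℝ} (hτ : 1 ≤ τ⁻¹) (b : ℝ) :
    b + τ⁻¹ * ∫ x, min (v x - b) 0 ∂μ ≤ ∫ x, v x ∂μ := by
  have hnonpos : ∫ x, min (v x - b) 0 ∂μ ≤ 0 :=
    integral_nonpos fun x => min_le_right _ _
  have hle : ∫ x, min (v x - b) 0 ∂μ ≤ ∫ x, (v x - b) ∂μ :=
    integral_mono (integrable_min_sub hv b) (hv.sub (integrable_const b))
      fun x => min_le_left _ _
  have hsub : ∫ x, (v x - b) ∂μ = ∫ x, v x ∂μ - b := by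
    rw [integral_sub hv (integrable_const b)]
    simp
  nlinarith

theorem cvar_objective_le_cvarLower {μ : Measure S} [IsProbabilityMeasure μ] {v : S → ℝ}
    (hv : Integrable v μ) {τ : ℝ} (hτ : 1 ≤ τ⁻¹) (b : ℝ) :
    b + τ⁻¹ * ∫ x, min (v x - b) 0 ∂μ ≤ cvarLower τ v μ :=
  le_ciSup (f := fun b : ℝ => b + τ⁻¹ * ∫ x, min (v x - b) 0 ∂μ)
    ⟨∫ x, v x ∂μ, by rintro _ ⟨c, rfl⟩; exact cvar_objective_le_integral hv hτ c⟩ b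

theorem cvar_objective_le_cvarLower_add {μ : Measure S} [IsProbabilityMeasure μ]
    {u v : S → ℝ} (hu : Integrable u μ) (hv : Integrable v μ) {τ : ℝ} (hτ : 1 ≤ τ⁻¹)
    {D : ℝ} (h : ∀ x, u x ≤ v x + D) (b : ℝ) :
    b + τ⁻¹ * ∫ x, min (u x - b) 0 ∂μ ≤ cvarLower τ v μ + D := by
  have hmono : ∫ x, min (u x - b) 0 ∂μ ≤ ∫ x, min (v x - (b - D)) 0 ∂μ :=
    integral_mono (integrable_min_sub hu b) (integrable_min_sub hv (b - D))
      fun x => min_le_min_right 0 (by linarith [h x])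
  have := mul_le_mul_of_nonneg_left hmono (zero_le_one.trans hτ)
  linarith [cvar_objective_le_cvarLower hv hτ (b - D)]

theorem betaBellman_le_robustBellman_add
    (P : Kernel (S × A) S) [IsMarkovKernel P] (π : Kernel S A) [IsMarkovKernel π]
    (r : S × A → ℝ) {γ : ℝ} (hγ : 0 ≤ γ) {Λ : S × A → ℝ} (hΛ : ∀ sa, 1 ≤ Λ sa)
    (β : S × A → ℝ) {f g : S × A → ℝ}
    (hf : Measurable f) {Mf : ℝ} (hMf : ∀ sa, |f sa| ≤ Mf)
    (hg : Measurable g) {Mg : ℝ} (hMg : ∀ sa, |g sa| ≤ Mg)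
    {D : ℝ} (h : ∀ sa, f sa ≤ g sa + D) (sa : S × A) :
    betaBellman P π r γ Λ β f sa ≤ robustBellman P π r γ Λ g sa + γ * D := by
  have hfi := integrable_vOf π hf hMf (P sa)
  have hgi := integrable_vOf π hg hMg (P sa)
  have hv := vOf_le_vOf_add π hf hMf hg hMg h
  have hτ : 1 ≤ (tauOf Λ sa)⁻¹ := by
    rw [tauOf, inv_inv]
    linarith [hΛ sa]
  have hlam0 : 0 ≤ lamOf Λ sa := sub_nonneg.2 (inv_le_one_of_one_le₀ (hΛ sa))
  have hlam1 : 0 ≤ 1 - lamOf Λ sa := by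
    simpa [lamOf] using zero_le_one.trans (hΛ sa)
  have hmean : ∫ s', vOf π f s' ∂(P sa) ≤ ∫ s', vOf π g s' ∂(P sa) + D := by
    calc ∫ s', vOf π f s' ∂(P sa) ≤ ∫ s', (vOf π g s' + D) ∂(P sa) :=
          integral_mono hfi (hgi.add (integrable_const D)) hv
      _ = _ := by
          rw [integral_add hgi (integrable_const D)]
          simp
  have hmean' := mul_le_mul_of_nonneg_left hmean (mul_nonneg hγ hlam1)
  have hcvar' := mul_le_mul_of_nonneg_left
    (cvar_objective_le_cvarLower_add hfi hgi hτ hv (β sa)) (mul_nonneg hγ hlam0)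
  unfold betaBellman robustBellman
  linarith

/-- The comparison goes through the `γ`-contracting robust operator, since the `β`-Bellman
operator need not be a contraction. -/
theorem betaBellman_fixedPoint_le_robustBellman_fixedPoint
    (P : Kernel (S × A) S) [IsMarkovKernel P] (π : Kernel S A) [IsMarkovKernel π]
    (r : S × A → ℝ) {γ : ℝ} (hγ : γ ∈ Set.Ico (0 : ℝ) 1)
    {Λ : S × A → ℝ} (hΛ : ∀ sa, 1 ≤ Λ sa) (β : S × A → ℝ) {f g : S × A → ℝ}
    (hf : Measurable f) {Mf : ℝ} (hMf : ∀ sa, |f sa| ≤ Mf)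
    (hg : Measurable g) {Mg : ℝ} (hMg : ∀ sa, |g sa| ≤ Mg)
    (hf_fixed : ∀ sa, f sa = betaBellman P π r γ Λ β f sa)
    (hg_fixed : ∀ sa, g sa = robustBellman P π r γ Λ g sa) (sa : S × A) :
    f sa ≤ g sa := by
  have hiter : ∀ n : ℕ, ∀ z, f z ≤ g z + γ ^ n * (Mf + Mg) := by
    intro n
    induction n with
    | zero =>
      intro z
      linarith [(abs_le.1 (hMf z)).2, (abs_le.1 (hMg z)).1]
    | succ n ih =>
      intro z
      have hz := betaBellman_le_robustBellman_add P π r hγ.1 hΛ β hf hMf hg hMg ih z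
      rw [← hf_fixed, ← hg_fixed] at hz
      rw [pow_succ']
      linarith
  have hlim : Filter.Tendsto (fun n : ℕ => g sa + γ ^ n * (Mf + Mg)) Filter.atTop
      (nhds (g sa)) := by
    simpa using ((tendsto_pow_atTop_nhds_zero_of_lt_one hγ.1 hγ.2).mul_const
      (Mf + Mg)).const_add (g sa)
  exact ge_of_tendsto' hlim fun n => hiter n sa

theorem integral_rho {B : Type*} (μ : Measure S) [IsProbabilityMeasure μ] (Λ β : S × B → ℝ)
    {v : S → ℝ} (hv : Integrable v μ) (sb : S × B) :
    ∫ s', rho Λ v β sb s' ∂μ =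
      (1 - lamOf Λ sb) * ∫ s', v s' ∂μ +
        lamOf Λ sb * (β sb + (tauOf Λ sb)⁻¹ * ∫ s', min (v s' - β sb) 0 ∂μ) := by
  have hmin := (integrable_min_sub hv (β sb)).const_mul (tauOf Λ sb)⁻¹
  have hsum : Integrable
      (fun s' => β sb + (tauOf Λ sb)⁻¹ * min (v s' - β sb) 0) μ :=
    (integrable_const _).add hmin
  unfold rho
  rw [integral_add (hv.const_mul _) (hsum.const_mul _),
    integral_const_mul, integral_const_mul, integral_add (integrable_const _) hmin,
    integral_const_mul]
  simp

theorem integrable_rho {B : Type*} (μ : Measure S) [IsProbabilityMeasure μ] (Λ β : S × B → ℝ)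
    {v : S → ℝ} (hv : Integrable v μ) (sb : S × B) : Integrable (rho Λ v β sb) μ :=
  (hv.const_mul _).add (((integrable_const _).add
    ((integrable_min_sub hv (β sb)).const_mul (tauOf Λ sb)⁻¹)).const_mul _)

/-- The conditional mean of `ψ` given `(s, a)` is the recentering plus the weighted
`β`-Bellman residual. -/
theorem integral_psi (P : Kernel (S × A) S) [IsMarkovKernel P] (π : Kernel S A)
    [IsMarkovKernel π] (r : S × A → ℝ) (γ : ℝ) (d1 : Measure S) (Λ w β : S × A → ℝ)
    {q : S × A → ℝ} (hq : Measurable q) {M : ℝ} (hM : ∀ sa, |q sa| ≤ M) (sa : S × A) :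
    ∫ s', psi π r γ d1 Λ w q β sa s' ∂(P sa) =
      (1 - γ) * (∫ s, vOf π q s ∂d1) +
        w sa * (betaBellman P π r γ Λ β q sa - q sa) := by
  have hv := integrable_vOf π hq hM (P sa)
  have hρ := (integrable_rho (P sa) Λ β hv sa).const_mul γ
  have hrρ : Integrable (fun s' => r sa + γ * rho Λ (vOf π q) β sa s') (P sa) :=
    (integrable_const (r sa)).add hρ
  have hres : Integrable
      (fun s' => w sa * (r sa + γ * rho Λ (vOf π q) β sa s' - q sa)) (P sa) :=
    (hrρ.sub (integrable_const (q sa))).const_mul (w sa)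
  have hsplit : ∫ s', psi π r γ d1 Λ w q β sa s' ∂(P sa) =
      (1 - γ) * (∫ s, vOf π q s ∂d1) +
        w sa * (r sa + γ * ∫ s', rho Λ (vOf π q) β sa s' ∂(P sa) - q sa) := by
    unfold psi
    rw [integral_add (integrable_const _) hres, integral_const_mul (w sa),
      integral_sub hrρ (integrable_const _), integral_add (integrable_const _) hρ,
      integral_const_mul γ]
    simp
  rw [hsplit, integral_rho (P sa) Λ β hv sa]
  unfold betaBellman
  ring

end BoundedFunctions

/-- Validity with `q_β = T_β⁻ q_β`: if `Q⁻` is the robust fixed point and `q_β` is a bounded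
measurable fixed point of the `β`-Bellman operator, then for every bounded measurable `w`,
`E_{ν,P}[ψ(s,a,s'; w, q_β, β)] = (1−γ) ∫ v_β dd₁ ≤ V⁻_{d₁}`. -/
theorem validity_beta_fixed_point
    {S A : Type*} [MeasurableSpace S] [MeasurableSpace A]
    (P : Kernel (S × A) S) [IsMarkovKernel P] (π : Kernel S A) [IsMarkovKernel π]
    (r : S × A → ℝ) (hr_meas : Measurable r) (hr_bdd : ∀ z, r z ∈ Set.Icc (0 : ℝ) 1)
    (γ : ℝ) (hγ : γ ∈ Set.Ico (0 : ℝ) 1)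
    (d1 : Measure S) [IsProbabilityMeasure d1]
    (ν : Measure (S × A)) [IsProbabilityMeasure ν]
    (Λ : S × A → ℝ) (hΛ_meas : Measurable Λ) (hΛ_lb : ∀ sa, 1 ≤ Λ sa)
    (MΛ : ℝ) (hΛ_ub : ∀ sa, Λ sa ≤ MΛ)
    (Qm : S × A → ℝ) (hQ_meas : Measurable Qm) (MQ : ℝ) (hQ_bdd : ∀ sa, |Qm sa| ≤ MQ)
    (hQ_fixed : ∀ sa, Qm sa = robustBellman P π r γ Λ Qm sa)
    (β : S × A → ℝ) (hβ_meas : Measurable β) (Mβ : ℝ) (hβ_bdd : ∀ sa, |β sa| ≤ Mβ)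
    (qβ : S × A → ℝ) (hqβ_meas : Measurable qβ) (Mqβ : ℝ) (hqβ_bdd : ∀ sa, |qβ sa| ≤ Mqβ)
    (hqβ_fixed : ∀ sa, qβ sa = betaBellman P π r γ Λ β qβ sa)
    (w : S × A → ℝ) (hw_meas : Measurable w) (Mw : ℝ) (hw_bdd : ∀ sa, |w sa| ≤ Mw) :
    (∫ sa, ∫ s', psi π r γ d1 Λ w qβ β sa s' ∂(P sa) ∂ν) =
      (1 - γ) * (∫ s, vOf π qβ s ∂d1) ∧
    (1 - γ) * (∫ s, vOf π qβ s ∂d1) ≤ (1 - γ) * (∫ s, vOf π Qm s ∂d1) := by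
  constructor
  · simp_rw [integral_psi P π r γ d1 Λ w β hqβ_meas hqβ_bdd, ← hqβ_fixed]
    simp
  · refine mul_le_mul_of_nonneg_left ?_ (sub_nonneg.2 hγ.2.le)
    have hle := betaBellman_fixedPoint_le_robustBellman_fixedPoint P π r hγ hΛ_lb β
      hqβ_meas hqβ_bdd hQ_meas hQ_bdd hqβ_fixed hQ_fixed
    refine integral_mono (integrable_vOf π hqβ_meas hqβ_bdd d1)
      (integrable_vOf π hQ_meas hQ_bdd d1) fun s => ?_
    exact integral_mono (integrable_kernel_section π hqβ_meas hqβ_bdd s)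
      (integrable_kernel_section π hQ_meas hQ_bdd s) fun a => hle (s, a)
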